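/- Under Assumption 1, if p ∈ ℝ^n and q ∈ ℝ^n both satisfy p ≥ 0, q ≥ 0, p = T(p) and q = T(q), then p = q; that is, the nonnegative solution of the fixed-point equation p = s + A^T p + Σ_{i=1}^n min{r_i + B_i^T p, 0} E_i is unique when it exists. -/

import Mathlib

open Matrix Finset

/-- `minZero v` is the minimum of the entries of `v` and of the scalar `0`. -/
noncomputable def minZero {k : ℕ} (v : Fin k → ℝ) : ℝ :=
  (insert (0 : ℝ) (Finset.image v Finset.univ)).min' (Finset.insert_nonempty _ _)

/-- The Bellman operator `T(p) = s + Aᵀ p + Σ_i min{r_i + B_iᵀ p, 0} E_i`. -/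
noncomputable def bellman {n : ℕ} {m : Fin n → ℕ}
    (A : Matrix (Fin n) (Fin n) ℝ) (B : ∀ i, Matrix (Fin n) (Fin (m i)) ℝ)
    (s : Fin n → ℝ) (r : ∀ i, Fin (m i) → ℝ) (E : Matrix (Fin n) (Fin n) ℝ)
    (p : Fin n → ℝ) : Fin n → ℝ :=
  fun j => s j + (Aᵀ *ᵥ p) j +
    ∑ i, minZero (fun l => r i l + ((B i)ᵀ *ᵥ p) l) * E i j

/-- Membership in the set 𝒦 of blockwise nonnegative feedback matrices with
full (`1ᵀ K_i = E_iᵀ`) or zero (`1ᵀ K_i = 0`) actuation in each block. -/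
def memK {n : ℕ} {m : Fin n → ℕ} (E : Matrix (Fin n) (Fin n) ℝ)
    (K : ∀ i, Matrix (Fin (m i)) (Fin n) ℝ) : Prop :=
  ∀ i, (∀ l j, 0 ≤ K i l j) ∧
    ((∀ j, ∑ l, K i l j = E i j) ∨ (∀ j, ∑ l, K i l j = 0))

/-- Assumption 1: `(A + BK) x ≥ 0` for every `K ∈ 𝒦` and every `x ≥ 0`. -/
def assumption1 {n : ℕ} {m : Fin n → ℕ}
    (A : Matrix (Fin n) (Fin n) ℝ) (B : ∀ i, Matrix (Fin n) (Fin (m i)) ℝ)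
    (E : Matrix (Fin n) (Fin n) ℝ) : Prop :=
  ∀ K : ∀ i, Matrix (Fin (m i)) (Fin n) ℝ, memK E K →
    ∀ x : Fin n → ℝ, 0 ≤ x → 0 ≤ (A + ∑ i, B i * K i) *ᵥ x

/-- The constraint set `U(x) = {u : u ≥ 0, 1ᵀ u_i ≤ E_iᵀ x for all i}`. -/
def inputSet {n : ℕ} {m : Fin n → ℕ} (E : Matrix (Fin n) (Fin n) ℝ)
    (x : Fin n → ℝ) : Set (∀ i, Fin (m i) → ℝ) :=
  {u | ∀ i, (∀ l, 0 ≤ u i l) ∧ (∑ l, u i l) ≤ ∑ j, E i j * x j}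

/-- An admissible trajectory from `x0`: `x(0) = x0`, `u(t) ∈ U(x(t))` and
`x(t+1) = A x(t) + B u(t)`. -/
def admissible {n : ℕ} {m : Fin n → ℕ}
    (A : Matrix (Fin n) (Fin n) ℝ) (B : ∀ i, Matrix (Fin n) (Fin (m i)) ℝ)
    (E : Matrix (Fin n) (Fin n) ℝ) (x0 : Fin n → ℝ)
    (x : ℕ → Fin n → ℝ) (u : ℕ → ∀ i, Fin (m i) → ℝ) : Prop :=
  x 0 = x0 ∧ ∀ t, u t ∈ inputSet E (x t) ∧
    x (t + 1) = A *ᵥ x t + ∑ i, (B i) *ᵥ (u t i)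

/-- The state trajectory generated by a control sequence `u` from `x0`. -/
noncomputable def traj {n : ℕ} {m : Fin n → ℕ}
    (A : Matrix (Fin n) (Fin n) ℝ) (B : ∀ i, Matrix (Fin n) (Fin (m i)) ℝ)
    (x0 : Fin n → ℝ) (u : ℕ → ∀ i, Fin (m i) → ℝ) : ℕ → Fin n → ℝ
  | 0 => x0
  | t + 1 => A *ᵥ traj A B x0 u t + ∑ i, (B i) *ᵥ (u t i)

/-- Total cost `Σ_{t=0}^∞ [sᵀ x(t) + rᵀ u(t)] ∈ [0,∞]` of a trajectory. -/
noncomputable def trajCost {n : ℕ} {m : Fin n → ℕ}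
    (s : Fin n → ℝ) (r : ∀ i, Fin (m i) → ℝ)
    (x : ℕ → Fin n → ℝ) (u : ℕ → ∀ i, Fin (m i) → ℝ) : ENNReal :=
  ∑' t, ENNReal.ofReal ((∑ j, s j * x t j) + ∑ i, ∑ l, r i l * u t i l)

/-- Optimal value `V(x0)`: infimum of the total cost over admissible trajectories. -/
noncomputable def optValue {n : ℕ} {m : Fin n → ℕ}
    (A : Matrix (Fin n) (Fin n) ℝ) (B : ∀ i, Matrix (Fin n) (Fin (m i)) ℝ)
    (E : Matrix (Fin n) (Fin n) ℝ) (s : Fin n → ℝ) (r : ∀ i, Fin (m i) → ℝ)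
    (x0 : Fin n → ℝ) : ENNReal :=
  ⨅ (x : ℕ → Fin n → ℝ) (u : ℕ → ∀ i, Fin (m i) → ℝ)
    (_ : admissible A B E x0 x u), trajCost s r x u

/-- The spectral radius of `M` is strictly less than `1`. -/
def schurStable {n : ℕ} (M : Matrix (Fin n) (Fin n) ℝ) : Prop :=
  ∀ μ ∈ spectrum ℂ (M.map Complex.ofReal), ‖μ‖ < 1

theorem minZero_le_zero {k : ℕ} (v : Fin k → ℝ) : minZero v ≤ 0 :=
  Finset.min'_le _ _ (Finset.mem_insert_self _ _)

theorem minZero_le_apply {k : ℕ} (v : Fin k → ℝ) (l : Fin k) : minZero v ≤ v l :=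
  Finset.min'_le _ _ (Finset.mem_insert_of_mem (Finset.mem_image_of_mem v (Finset.mem_univ l)))

/-- `minZero` is a minimum of linear functionals with nonnegative weights of total mass
`1` or `0`, and the minimum is attained. -/
theorem exists_weights_minZero {k : ℕ} (v : Fin k → ℝ) :
    ∃ w : Fin k → ℝ, (∀ l, 0 ≤ w l) ∧ (∑ l, w l = 1 ∨ ∑ l, w l = 0) ∧
      minZero v = ∑ l, w l * v l ∧ ∀ v' : Fin k → ℝ, minZero v' ≤ ∑ l, w l * v' l := by
  have hmem : minZero v ∈ insert (0 : ℝ) (Finset.image v Finset.univ) := Finset.min'_mem _ _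
  rcases Finset.mem_insert.1 hmem with h | h
  · exact ⟨0, by simp, by simp, by simp [h], fun v' => by simpa using minZero_le_zero v'⟩
  · obtain ⟨l₀, -, hl₀⟩ := Finset.mem_image.1 h
    refine ⟨Pi.single l₀ 1, fun l => ?_, by simp, ?_, fun v' => ?_⟩
    · by_cases hl : l = l₀ <;> simp [hl]
    · simp [Pi.single_apply, hl₀]
    · simpa [Pi.single_apply] using minZero_le_apply v' l₀

/-- The affine form of the Bellman operator obtained by replacing each minimum with a
weighted sum. -/
theorem weighted_bellman_eq {n : ℕ} {m : Fin n → ℕ}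
    (A : Matrix (Fin n) (Fin n) ℝ) (B : ∀ i, Matrix (Fin n) (Fin (m i)) ℝ)
    (r : ∀ i, Fin (m i) → ℝ) (E : Matrix (Fin n) (Fin n) ℝ)
    (w : ∀ i, Fin (m i) → ℝ) (p : Fin n → ℝ) (j : Fin n) :
    (Aᵀ *ᵥ p) j + ∑ i, (∑ l, w i l * (r i l + ((B i)ᵀ *ᵥ p) l)) * E i j =
      ∑ i, (∑ l, w i l * r i l) * E i j +
        ((A + ∑ i, B i * Matrix.of fun l j => w i l * E i j)ᵀ *ᵥ p) j := by
  have h : ∀ i, ((B i * Matrix.of fun l j => w i l * E i j)ᵀ *ᵥ p) j =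
      (∑ l, w i l * ((B i)ᵀ *ᵥ p) l) * E i j := by
    intro i
    rw [Matrix.transpose_mul, ← Matrix.mulVec_mulVec]
    simp only [Matrix.mulVec, dotProduct, Matrix.transpose_apply, Matrix.of_apply,
      Finset.sum_mul]
    exact Finset.sum_congr rfl fun l _ => by ring
  rw [Matrix.transpose_add, Matrix.transpose_sum, Matrix.add_mulVec, Matrix.sum_mulVec,
    Pi.add_apply, Finset.sum_apply]
  simp only [h, mul_add, Finset.sum_add_distrib, add_mul]
  ring

/-- The Bellman operator is dominated by an affine map with nonnegative linear part and
nonnegative extra cost, with equality at a given point. -/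
theorem exists_affine_majorant_bellman {n : ℕ} {m : Fin n → ℕ}
    {A : Matrix (Fin n) (Fin n) ℝ} {B : ∀ i, Matrix (Fin n) (Fin (m i)) ℝ}
    {r : ∀ i, Fin (m i) → ℝ} {E : Matrix (Fin n) (Fin n) ℝ}
    (s : Fin n → ℝ) (hr : ∀ i l, 0 ≤ r i l) (hE : ∀ i j, 0 ≤ E i j)
    (hA1 : assumption1 A B E) (p : Fin n → ℝ) :
    ∃ (c : Fin n → ℝ) (M : Matrix (Fin n) (Fin n) ℝ),
      (∀ j, 0 ≤ c j) ∧ (∀ i j, 0 ≤ M i j) ∧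
      (∀ j, bellman A B s r E p j = s j + c j + (M *ᵥ p) j) ∧
      ∀ q j, bellman A B s r E q j ≤ s j + c j + (M *ᵥ q) j := by
  choose w hw0 hw1 hwp hwle using
    fun i => exists_weights_minZero (fun l => r i l + ((B i)ᵀ *ᵥ p) l)
  refine ⟨fun j => ∑ i, (∑ l, w i l * r i l) * E i j,
    (A + ∑ i, B i * Matrix.of fun l j => w i l * E i j)ᵀ, fun j => ?_, fun i j => ?_,
    fun j => ?_, fun q j => ?_⟩
  · exact Finset.sum_nonneg fun i _ => mul_nonneg
      (Finset.sum_nonneg fun l _ => mul_nonneg (hw0 i l) (hr i l)) (hE i j)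
  · have hK : memK E fun i => Matrix.of fun l j => w i l * E i j := by
      refine fun i => ⟨fun l j => mul_nonneg (hw0 i l) (hE i j), ?_⟩
      refine (hw1 i).imp (fun h j => ?_) fun h j => ?_ <;>
        simp [← Finset.sum_mul, h]
    have h := hA1 _ hK (Pi.single i 1) (Pi.single_nonneg.2 zero_le_one) j
    rwa [Matrix.mulVec_single_one] at h
  · have h := weighted_bellman_eq A B r E w p j
    simp only [bellman, hwp]
    linarith
  · have h := weighted_bellman_eq A B r E w q j
    have hle := Finset.sum_le_sum fun i (_ : i ∈ Finset.univ) =>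
      mul_le_mul_of_nonneg_right (hwle i fun l => r i l + ((B i)ᵀ *ᵥ q) l) (hE i j)
    simp only [bellman]
    linarith

/-- A subinvariant vector of a nonnegative matrix `M` is nonpositive as soon as `M` has a
strictly superinvariant positive vector. -/
theorem nonpos_of_le_mulVec {ι : Type*} [Fintype ι] {M : Matrix ι ι ℝ}
    (hM : ∀ i j, 0 ≤ M i j) {p d : ι → ℝ} (hp : ∀ j, 0 < p j)
    (hMp : ∀ j, (M *ᵥ p) j < p j) (hd : ∀ j, d j ≤ (M *ᵥ d) j) (j : ι) : d j ≤ 0 := by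
  by_contra! hj
  obtain ⟨k, -, hk⟩ := Finset.exists_max_image Finset.univ (fun i => d i / p i)
    ⟨j, Finset.mem_univ j⟩
  have hpos : 0 < d k / p k := (div_pos hj (hp j)).trans_le (hk j (Finset.mem_univ j))
  have hle : (M *ᵥ d) k ≤ d k / p k * (M *ᵥ p) k := by
    simp only [Matrix.mulVec, dotProduct, Finset.mul_sum]
    refine Finset.sum_le_sum fun i _ => ?_
    rw [mul_left_comm]
    exact mul_le_mul_of_nonneg_left ((div_le_iff₀ (hp i)).1 (hk i (Finset.mem_univ i))) (hM k i)
  have hlt := mul_lt_mul_of_pos_left (hMp k) hpos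
  rw [div_mul_cancel₀ _ (hp k).ne'] at hlt
  exact absurd (hd k) (hle.trans_lt hlt).not_ge

/-- Every fixed point of the Bellman operator lies below every nonnegative one. -/
theorem le_of_bellman_fixed {n : ℕ} {m : Fin n → ℕ}
    {A : Matrix (Fin n) (Fin n) ℝ} {B : ∀ i, Matrix (Fin n) (Fin (m i)) ℝ}
    {s : Fin n → ℝ} {r : ∀ i, Fin (m i) → ℝ} {E : Matrix (Fin n) (Fin n) ℝ}
    (hs : ∀ j, 0 < s j) (hr : ∀ i l, 0 ≤ r i l) (hE : ∀ i j, 0 ≤ E i j)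
    (hA1 : assumption1 A B E) {p q : Fin n → ℝ} (hp : 0 ≤ p)
    (hfixp : p = bellman A B s r E p) (hfixq : q = bellman A B s r E q) : q ≤ p := by
  obtain ⟨c, M, hc, hM, heq, hle⟩ := exists_affine_majorant_bellman s hr hE hA1 p
  have hp_eq : ∀ j, p j = s j + c j + (M *ᵥ p) j := fun j => (congrFun hfixp j).trans (heq j)
  have hMp : ∀ j, (M *ᵥ p) j < p j := fun j => by linarith [hp_eq j, hs j, hc j]
  have hp_pos : ∀ j, 0 < p j := fun j =>
    (dotProduct_nonneg_of_nonneg (hM j) hp).trans_lt (hMp j)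
  intro j
  refine sub_nonpos.1 (nonpos_of_le_mulVec (d := q - p) hM hp_pos hMp (fun k => ?_) j)
  have hq_le := (congrFun hfixq k).trans_le (hle q k)
  rw [Matrix.mulVec_sub, Pi.sub_apply, Pi.sub_apply]
  linarith [hp_eq k]

/-- under Assumption 1, the nonnegative solution of the fixed-point
equation `p = T(p)` is unique when it exists. -/
theorem stmt_9 {n : ℕ} {m : Fin n → ℕ}
    (A : Matrix (Fin n) (Fin n) ℝ) (B : ∀ i, Matrix (Fin n) (Fin (m i)) ℝ)
    (s : Fin n → ℝ) (r : ∀ i, Fin (m i) → ℝ) (E : Matrix (Fin n) (Fin n) ℝ)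
    (hs : ∀ j, 0 < s j) (hr : ∀ i l, 0 ≤ r i l)
    (hE : ∀ i j, 0 ≤ E i j) (hEinv : IsUnit E.det)
    (hA1 : assumption1 A B E)
    (p q : Fin n → ℝ) (hp : 0 ≤ p) (hq : 0 ≤ q)
    (hfixp : p = bellman A B s r E p) (hfixq : q = bellman A B s r E q) :
    p = q := by
  exact le_antisymm (le_of_bellman_fixed hs hr hE hA1 hq hfixq hfixp)
    (le_of_bellman_fixed hs hr hE hA1 hp hfixp hfixq)
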